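/- Let λ ∈ {1,2} and m ∈ {2,3}. Then every natural number n can be written as n = x^2 + y^2 + z^2 + w^2 with x, y, z, w integers such that x + 2y + 3z - w = λ·r^m for some nonnegative integer r. -/

import Mathlib

theorem exists_two_mul_add_mul_mem_Icc (a b : ℤ) (ha : 0 < a) :
    ∃ t : ℤ, -a ≤ 2 * (b + t * a) ∧ 2 * (b + t * a) ≤ a := by
  refine ⟨-((2 * b + a) / (2 * a)), ?_⟩
  have h₁ := Int.emod_nonneg (2 * b + a) (b := 2 * a) (by omega)
  have h₂ := Int.emod_lt_of_pos (2 * b + a) (b := 2 * a) (by omega)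
  have h₃ := Int.emod_add_mul_ediv (2 * b + a) (2 * a)
  constructor <;> linarith

theorem exists_reduced_binary_form (A B C D : ℤ) (hA : 0 < A) (hD : A * C - B ^ 2 = D)
    (hD0 : 0 < D) :
    ∃ p q r s : ℤ, p * s - q * r = 1 ∧ 0 < A * p ^ 2 + 2 * B * p * r + C * r ^ 2 ∧
      3 * (A * p ^ 2 + 2 * B * p * r + C * r ^ 2) ^ 2 ≤ 4 * D := by
  induction hk : A.toNat using Nat.strong_induction_on generalizing A B C with
  | _ k ih =>
    obtain ⟨t, ht₁, ht₂⟩ := exists_two_mul_add_mul_mem_Icc A B hA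
    set B' := B + t * A with hB'
    set C' := A * t ^ 2 + 2 * B * t + C with hC'
    have hD' : A * C' - B' ^ 2 = D := by rw [← hD, hB', hC']; ring
    have hC0 : 0 < C' := by
      by_contra! h
      nlinarith [sq_nonneg B']
    by_cases hlt : C' < A
    · obtain ⟨p, q, r, s, h₁, h₂, h₃⟩ :=
        ih C'.toNat (by omega) C' (-B') A hC0 (by rw [← hD']; ring) rfl
      have key : A * (t * p - r) ^ 2 + 2 * B * (t * p - r) * p + C * p ^ 2 =
          C' * p ^ 2 + 2 * (-B') * p * r + A * r ^ 2 := by rw [hB', hC']; ring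
      refine ⟨t * p - r, t * q - s, p, q, by linarith, ?_, ?_⟩
      · rw [key]; exact h₂
      · rw [key]; exact h₃
    · refine ⟨1, 0, 0, 1, by ring, by linarith, ?_⟩
      have : B' ^ 2 * 4 ≤ A ^ 2 := by nlinarith
      nlinarith

theorem sum_three_squares_of_ternary_form (a b c f g h : ℤ) (ha : 0 < a)
    (hab : 0 < a * b - h ^ 2)
    (hdet : a * b * c + 2 * f * g * h - a * f ^ 2 - b * g ^ 2 - c * h ^ 2 = 1) (x y z : ℤ) :
    ∃ u v w : ℤ, a * x ^ 2 + b * y ^ 2 + c * z ^ 2 + 2 * f * y * z + 2 * g * x * z +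
      2 * h * x * y = u ^ 2 + v ^ 2 + w ^ 2 := by
  induction hk : a.toNat using Nat.strong_induction_on generalizing a b c f g h x y z with
  | _ k ih =>
    obtain ⟨p, q, r, s, hps, hG, hGa⟩ :=
      exists_reduced_binary_form (a * b - h ^ 2) (a * f - g * h) (a * c - g ^ 2) a hab
        (by linear_combination a * hdet) ha
    set y' := s * y - q * z with hy'
    set z' := p * z - r * y with hz'
    have hy : y = p * y' + q * z' := by rw [hy', hz']; linear_combination (-y) * hps
    have hz : z = r * y' + s * z' := by rw [hy', hz']; linear_combination (-z) * hps
    clear_value y' z'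
    subst hy hz
    set b₁ := b * p ^ 2 + 2 * f * p * r + c * r ^ 2 with hb₁
    set c₁ := b * q ^ 2 + 2 * f * q * s + c * s ^ 2 with hc₁
    set f₁ := b * p * q + f * (p * s + q * r) + c * r * s with hf₁
    set h₁ := h * p + g * r with hh₁
    set g₁ := h * q + g * s with hg₁
    have hG₁ : (a * b - h ^ 2) * p ^ 2 + 2 * (a * f - g * h) * p * r + (a * c - g ^ 2) * r ^ 2 =
        a * b₁ - h₁ ^ 2 := by rw [hb₁, hh₁]; ring
    rw [hG₁] at hG hGa
    have hdet₁ : a * b₁ * c₁ + 2 * f₁ * g₁ * h₁ - a * f₁ ^ 2 - b₁ * g₁ ^ 2 - c₁ * h₁ ^ 2 = 1 := by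
      have : a * b₁ * c₁ + 2 * f₁ * g₁ * h₁ - a * f₁ ^ 2 - b₁ * g₁ ^ 2 - c₁ * h₁ ^ 2 =
        (a * b * c + 2 * f * g * h - a * f ^ 2 - b * g ^ 2 - c * h ^ 2) *
          (p * s - q * r) ^ 2 := by rw [hb₁, hc₁, hf₁, hh₁, hg₁]; ring
      rw [this, hdet, hps]; norm_num
    have hQ : a * x ^ 2 + b * (p * y' + q * z') ^ 2 + c * (r * y' + s * z') ^ 2 +
        2 * f * (p * y' + q * z') * (r * y' + s * z') + 2 * g * x * (r * y' + s * z') +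
        2 * h * x * (p * y' + q * z') =
        a * x ^ 2 + b₁ * y' ^ 2 + c₁ * z' ^ 2 + 2 * f₁ * y' * z' + 2 * g₁ * x * z' +
        2 * h₁ * x * y' := by rw [hb₁, hc₁, hf₁, hh₁, hg₁]; ring
    rw [hQ]
    clear_value b₁ c₁ f₁ g₁ h₁
    clear hQ hG₁ hdet hab hps
    by_cases ha1 : a = 1
    · subst ha1
      have hG1 : 1 * b₁ - h₁ ^ 2 = 1 := by nlinarith
      have hb : b₁ = 1 + h₁ ^ 2 := by linarith
      subst hb
      refine ⟨x + h₁ * y' + g₁ * z', y' + (f₁ - g₁ * h₁) * z', z', ?_⟩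
      linear_combination z' ^ 2 * hdet₁
    · obtain ⟨t, ht₁, ht₂⟩ := exists_two_mul_add_mul_mem_Icc a h₁ ha
      set h₂ := h₁ + t * a with hh₂
      set b₂ := a * t ^ 2 + 2 * h₁ * t + b₁ with hb₂
      have hG₂ : a * b₂ - h₂ ^ 2 = a * b₁ - h₁ ^ 2 := by rw [hb₂, hh₂]; ring
      have hb0 : 0 < b₂ := by
        by_contra! hb
        nlinarith [sq_nonneg h₂]
      have hh4 : h₂ ^ 2 * 4 ≤ a ^ 2 := by nlinarith
      have hlt : b₂ < a := by
        by_contra! hba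
        rw [← hG₂] at hG hGa
        have h3 : 3 * a ^ 2 ≤ 4 * (a * b₂ - h₂ ^ 2) := by nlinarith
        generalize a * b₂ - h₂ ^ 2 = G at hG hGa h3
        have h9 : (3 * a ^ 2) ^ 2 ≤ (4 * G) ^ 2 := pow_le_pow_left₀ (by positivity) h3 2
        have h27 : a * (27 * a ^ 3) ≤ a * 64 := by linarith
        have h64 := le_of_mul_le_mul_left h27 ha
        have ha2 : 2 ≤ a := by omega
        have := pow_le_pow_left₀ (by norm_num) ha2 3
        linarith
      obtain ⟨u, v, w, huvw⟩ := ih b₂.toNat (by omega) b₂ a c₁ g₁ (f₁ + t * g₁) h₂ hb0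
        (by linarith) (by rw [← hdet₁, hb₂, hh₂]; ring) y' (x - t * y') z' rfl
      exact ⟨u, v, w, by rw [← huvw, hb₂, hh₂]; ring⟩

theorem sum_three_squares_of_dvd (n d k : ℤ) (hn : 2 ≤ n) (hd : 0 < d)
    (h : d * n - 1 ∣ k ^ 2 + d) : ∃ u v w : ℤ, n = u ^ 2 + v ^ 2 + w ^ 2 := by
  obtain ⟨m, hm⟩ := h
  have hm0 : 0 < m := by
    by_contra! hm'
    have : 0 < d * n - 1 := by nlinarith
    nlinarith [sq_nonneg k]
  obtain ⟨u, v, w, h⟩ := sum_three_squares_of_ternary_form m (d * n - 1) n 0 1 k hm0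
    (by linarith) (by linear_combination (-n) * hm) 0 0 1
  exact ⟨u, v, w, by linarith⟩

theorem exists_dvd_sq_add_of_jacobiSym_eq_one {p d : ℕ} (hp : p.Prime)
    (h : jacobiSym (-d) p = 1) : ∃ k : ℤ, (p : ℤ) ∣ k ^ 2 + d := by
  have := Fact.mk hp
  obtain ⟨k, hk⟩ := ZMod.isSquare_of_jacobiSym_eq_one h
  refine ⟨k.valMinAbs, (ZMod.intCast_zmod_eq_zero_iff_dvd _ p).mp ?_⟩
  push_cast [ZMod.coe_valMinAbs] at hk ⊢
  linear_combination -hk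

theorem exists_prime_eq_add_four_mul_mul {n a : ℤ} (hn : 0 < n) (ha : a % 2 = 1)
    (han : IsCoprime a n) : ∃ p j : ℕ, p.Prime ∧ (p : ℤ) = a + 4 * n * j := by
  have h2 : IsCoprime a 2 := ⟨1, -(a / 2), by omega⟩
  have h4 : IsCoprime a ((4 * n).toNat : ℤ) := by
    rw [Int.toNat_of_nonneg (by omega), show (4 : ℤ) = 2 * 2 by norm_num]
    exact (h2.mul_right h2).mul_right han
  obtain ⟨p, hpa, hp, hmod⟩ :=
    Nat.forall_exists_prime_gt_and_zmodEq a.toNat (by omega : (4 * n).toNat ≠ 0) h4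
  rw [Int.toNat_of_nonneg (by omega)] at hmod
  obtain ⟨j, hj⟩ := hmod.symm.dvd
  have hj0 : 0 ≤ j := by
    by_contra! h
    have : 4 * n * j < 0 := mul_neg_of_pos_of_neg (by omega) h
    omega
  exact ⟨p, j.toNat, hp, by rw [Int.toNat_of_nonneg hj0]; linarith⟩

theorem sum_three_squares_of_mod_four_eq_two {n : ℤ} (hn0 : 0 < n) (hn : n % 4 = 2) :
    ∃ u v w : ℤ, n = u ^ 2 + v ^ 2 + w ^ 2 := by
  obtain ⟨p, j, hp, hpj⟩ := exists_prime_eq_add_four_mul_mul hn0 (a := n - 1) (by omega)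
    ⟨-1, 1, by ring⟩
  set d : ℕ := 4 * j + 1 with hd
  have hpd : (d : ℤ) * n - 1 = p := by rw [hpj, hd]; push_cast; ring
  have hp4 : p % 4 = 1 := by
    have : (p : ℤ) = n - 1 + 4 * (n * j) := by rw [hpj]; ring
    omega
  have hdodd : Odd d := Nat.odd_iff.mpr (by omega)
  have hJ : jacobiSym (-d) p = 1 := by
    rw [jacobiSym.neg _ (Nat.odd_iff.mpr (by omega)), ZMod.χ₄_nat_one_mod_four hp4, one_mul,
      jacobiSym.quadratic_reciprocity_one_mod_four (by omega) (Nat.odd_iff.mpr (by omega)),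
      jacobiSym.mod_left' (a₂ := -1), jacobiSym.at_neg_one hdodd,
      ZMod.χ₄_nat_one_mod_four (by omega)]
    exact Int.modEq_iff_dvd.mpr ⟨-n, by linarith⟩
  obtain ⟨k, hk⟩ := exists_dvd_sq_add_of_jacobiSym_eq_one hp hJ
  exact sum_three_squares_of_dvd n d k (by omega) (by omega) (hpd ▸ hk)

theorem sum_three_squares_of_odd {n : ℤ} (hn0 : 1 < n)
    (hn : n % 8 = 1 ∨ n % 8 = 3 ∨ n % 8 = 5) :
    ∃ u v w : ℤ, n = u ^ 2 + v ^ 2 + w ^ 2 := by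
  obtain ⟨c, a, hca, hc⟩ : ∃ (c : ℕ) (a : ℤ), c * n - 1 = 2 * a ∧
      (a % 4 = 1 ∧ (c = 1 ∨ c = 3) ∨ a % 4 = 3 ∧ c = 3) := by
    rcases hn with h | h | h
    · exact ⟨3, 12 * (n / 8) + 1, by omega, by omega⟩
    · exact ⟨1, 4 * (n / 8) + 1, by omega, by omega⟩
    · exact ⟨3, 12 * (n / 8) + 7, by omega, by omega⟩
  obtain ⟨p, j, hp, hpj⟩ := exists_prime_eq_add_four_mul_mul (n := n) (a := a) (by omega)
    (by omega) ⟨-2, c, by linarith⟩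
  set d : ℕ := 8 * j + c with hd
  have hpd : (d : ℤ) * n - 1 = 2 * p := by
    rw [hpj, hd]; push_cast; linear_combination hca
  have hpa : (p : ℤ) % 4 = a % 4 := by
    have : (p : ℤ) = a + 4 * (n * j) := by rw [hpj]; ring
    omega
  have hdodd : Odd d := Nat.odd_iff.mpr (by omega)
  have hpodd : Odd p := Nat.odd_iff.mpr (by omega)
  have hpd1 : jacobiSym p d = 1 := by
    have h1 : jacobiSym (-2) d = 1 := by
      rw [jacobiSym.at_neg_two hdodd, ZMod.χ₈'_nat_eq_if_mod_eight, if_neg (by omega),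
        if_pos (by omega)]
    have h2 : jacobiSym (-2 * p) d = jacobiSym 1 d :=
      jacobiSym.mod_left' (Int.modEq_iff_dvd.mpr ⟨n, by linarith⟩)
    rwa [jacobiSym.mul_left, h1, one_mul, jacobiSym.one_left] at h2
  have hJ : jacobiSym (-d) p = 1 := by
    rw [jacobiSym.neg _ hpodd]
    rcases hc with ⟨ha, -⟩ | ⟨ha, hc⟩
    · rw [ZMod.χ₄_nat_one_mod_four (by omega),
        jacobiSym.quadratic_reciprocity_one_mod_four' hdodd (by omega), hpd1, one_mul]
    · rw [ZMod.χ₄_nat_three_mod_four (by omega),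
        jacobiSym.quadratic_reciprocity_three_mod_four (by omega) (by omega), hpd1]
      norm_num
  obtain ⟨k, hk⟩ := exists_dvd_sq_add_of_jacobiSym_eq_one hp hJ
  have hp2 : IsCoprime (2 : ℤ) p := by
    exact ⟨-((p : ℤ) / 2), 1, by omega⟩
  obtain ⟨k', hk', hk2⟩ : ∃ k' : ℤ, (p : ℤ) ∣ k' ^ 2 + d ∧ k' % 2 = 1 := by
    rcases Int.emod_two_eq_zero_or_one k with h | h
    · refine ⟨k + p, ?_, by omega⟩
      have : (k + p) ^ 2 + (d : ℤ) = (k ^ 2 + d) + p * (2 * k + p) := by ring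
      rw [this]
      exact dvd_add hk (dvd_mul_right _ _)
    · exact ⟨k, hk, h⟩
  refine sum_three_squares_of_dvd n d k' (by omega) (by omega) (hpd ▸ hp2.mul_dvd ?_ hk')
  rw [← even_iff_two_dvd]
  exact ((Int.odd_iff.mpr hk2).pow).add_odd (mod_cast hdodd)

theorem sum_three_squares {n : ℤ} (hn0 : 0 < n) (h4 : n % 4 ≠ 0) (h7 : n % 8 ≠ 7) :
    ∃ u v w : ℤ, n = u ^ 2 + v ^ 2 + w ^ 2 := by
  by_cases h1 : n = 1
  · exact ⟨1, 0, 0, by simp [h1]⟩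
  by_cases h2 : n % 4 = 2
  · exact sum_three_squares_of_mod_four_eq_two hn0 h2
  · exact sum_three_squares_of_odd (by omega) (by omega)

theorem exists_signs_dvd_three (s A B C : ℤ) (h : 3 ∣ s ^ 2 + A ^ 2 + B ^ 2 + C ^ 2) :
    ∃ A' B' C' : ℤ, A' ^ 2 + B' ^ 2 + C' ^ 2 = A ^ 2 + B ^ 2 + C ^ 2 ∧
      3 ∣ A' + B' + C' ∧ 3 ∣ s + B' - C' := by
  have key : ∀ s A B C : ZMod 3, s ^ 2 + A ^ 2 + B ^ 2 + C ^ 2 = 0 →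
      (A + B + C = 0 ∧ s + B - C = 0) ∨ (A - B - C = 0 ∧ s - B + C = 0) ∨
      (-A + B - C = 0 ∧ s + B + C = 0) ∨ (-A - B + C = 0 ∧ s - B - C = 0) := by decide
  have hdvd (a : ℤ) : 3 ∣ a ↔ (a : ZMod 3) = 0 := (ZMod.intCast_zmod_eq_zero_iff_dvd a 3).symm
  simp only [hdvd] at h ⊢
  push_cast at h ⊢
  rcases key s A B C h with h | h | h | h
  · exact ⟨A, B, C, rfl, h⟩
  · exact ⟨A, -B, -C, by ring, by push_cast; simpa [sub_eq_add_neg] using h⟩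
  · exact ⟨-A, B, -C, by ring, by push_cast; simpa [sub_eq_add_neg] using h⟩
  · exact ⟨-A, -B, C, by ring, by push_cast; simpa [sub_eq_add_neg] using h⟩

theorem exists_dvd_fifteen (s A B C : ℤ) (h : 15 ∣ s ^ 2 + A ^ 2 + B ^ 2 + C ^ 2) :
    ∃ A' B' C' : ℤ, A' ^ 2 + B' ^ 2 + C' ^ 2 = A ^ 2 + B ^ 2 + C ^ 2 ∧
      15 ∣ 3 * s - A' - B' + 2 * C' ∧ 15 ∣ s + 3 * A' - 2 * B' - C' ∧
      15 ∣ s + 2 * A' + 3 * B' + C' ∧ 15 ∣ -2 * s + A' - B' + 3 * C' := by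
  obtain ⟨A, B, C, hsq, h3, h3'⟩ : ∃ A' B' C' : ℤ, A' ^ 2 + B' ^ 2 + C' ^ 2 =
      A ^ 2 + B ^ 2 + C ^ 2 ∧ 3 ∣ A' + B' + C' ∧ 3 ∣ s + B' - C' :=
    exists_signs_dvd_three s A B C (by omega)
  rw [← hsq]
  have key : ∀ s A B C : ZMod 5, s ^ 2 + A ^ 2 + B ^ 2 + C ^ 2 = 0 →
      ∃ t ∈ [(A, B, C), (B, C, A), (C, A, B), (-B, -A, -C), (-A, -C, -B), (-C, -B, -A)],
      3 * s - t.1 - t.2.1 + 2 * t.2.2 = 0 ∧ s + 3 * t.1 - 2 * t.2.1 - t.2.2 = 0 ∧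
      s + 2 * t.1 + 3 * t.2.1 + t.2.2 = 0 ∧ -2 * s + t.1 - t.2.1 + 3 * t.2.2 = 0 := by
    decide
  have hdvd (a : ℤ) : 5 ∣ a ↔ (a : ZMod 5) = 0 := (ZMod.intCast_zmod_eq_zero_iff_dvd a 5).symm
  have hz := (hdvd (s ^ 2 + A ^ 2 + B ^ 2 + C ^ 2)).mp (by omega)
  push_cast at hz
  suffices ∃ t ∈ [(A, B, C), (B, C, A), (C, A, B), (-B, -A, -C), (-A, -C, -B), (-C, -B, -A)],
      5 ∣ 3 * s - t.1 - t.2.1 + 2 * t.2.2 ∧ 5 ∣ s + 3 * t.1 - 2 * t.2.1 - t.2.2 ∧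
      5 ∣ s + 2 * t.1 + 3 * t.2.1 + t.2.2 ∧ 5 ∣ -2 * s + t.1 - t.2.1 + 3 * t.2.2 by
    obtain ⟨t, ht, h5⟩ := this
    refine ⟨t.1, t.2.1, t.2.2, ?_⟩
    simp only [List.mem_cons, List.not_mem_nil, or_false] at ht
    rcases ht with rfl | rfl | rfl | rfl | rfl | rfl <;>
      exact ⟨by ring, by dsimp only at h5 ⊢; omega⟩
  simp only [hdvd]
  simpa using key s A B C hz

theorem exists_four_squares_of_three_squares {n s A B C : ℤ}
    (h : 15 * n - s ^ 2 = A ^ 2 + B ^ 2 + C ^ 2) :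
    ∃ x y z w : ℤ, n = x ^ 2 + y ^ 2 + z ^ 2 + w ^ 2 ∧ x + 2 * y + 3 * z - w = s := by
  obtain ⟨A, B, C, hsq, ⟨z, hz⟩, ⟨x, hx⟩, ⟨w, hw⟩, ⟨y, hy⟩⟩ :=
    exists_dvd_fifteen s A B C ⟨n, by linarith⟩
  refine ⟨x, -y, z, -w, ?_, by linarith⟩
  have : 225 * n = 225 * (x ^ 2 + (-y) ^ 2 + z ^ 2 + (-w) ^ 2) := by
    linear_combination 15 * h - 15 * hsq + (3 * s - A - B + 2 * C + 15 * z) * hz +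
      (s + 3 * A - 2 * B - C + 15 * x) * hx + (s + 2 * A + 3 * B + C + 15 * w) * hw +
      (-2 * s + A - B + 3 * C + 15 * y) * hy
  linarith

/-- `n` is a sum of four squares with `x + 2 * y + 3 * z - w` equal to `l` times an `m`-th power. -/
def IsRestrictedSum (l : ℤ) (m : ℕ) (n : ℤ) : Prop :=
  ∃ x y z w : ℤ, n = x ^ 2 + y ^ 2 + z ^ 2 + w ^ 2 ∧
    ∃ r : ℕ, x + 2 * y + 3 * z - w = l * (r : ℤ) ^ m

theorem IsRestrictedSum.four_pow_mul {l : ℤ} {m : ℕ} {n : ℤ} (h : IsRestrictedSum l m n) :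
    IsRestrictedSum l m (4 ^ m * n) := by
  obtain ⟨x, y, z, w, hn, r, hr⟩ := h
  refine ⟨2 ^ m * x, 2 ^ m * y, 2 ^ m * z, 2 ^ m * w, ?_, 2 * r, ?_⟩
  · rw [hn, show (4 : ℤ) = 2 ^ 2 by norm_num, ← pow_mul, mul_comm 2 m, pow_mul]; ring
  · push_cast
    rw [mul_pow]
    linear_combination 2 ^ m * hr

theorem isRestrictedSum_of_three_squares {l : ℤ} {m : ℕ} {n : ℤ} (r : ℕ) (a N : ℤ)
    (hN : 15 * n - (l * r ^ m) ^ 2 = a ^ 2 * N) (hN0 : 0 < N) (h4 : N % 4 ≠ 0)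
    (h7 : N % 8 ≠ 7) : IsRestrictedSum l m n := by
  obtain ⟨u, v, w, h⟩ := sum_three_squares hN0 h4 h7
  obtain ⟨x, y, z, w, hn, hs⟩ := exists_four_squares_of_three_squares (n := n)
    (s := l * r ^ m) (A := a * u) (B := a * v) (C := a * w) (by rw [hN, h]; ring)
  exact ⟨x, y, z, w, hn, r, hs⟩

theorem exists_eq_four_pow_mul {n : ℕ} (hn : 0 < n) : ∃ k N : ℕ, n = 4 ^ k * N ∧ N % 4 ≠ 0 := by
  obtain ⟨k, N, hN, h⟩ := Nat.exists_eq_pow_mul_and_not_dvd hn.ne' 4 (by norm_num)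
  exact ⟨k, N, h, by omega⟩

theorem isRestrictedSum_four_pow_mul {l : ℤ} (hl : l = 1 ∨ l = 2) {m : ℕ} (hm : m = 2 ∨ m = 3)
    {N : ℤ} (hN0 : 0 < N) (hN : N % 8 = 1) (k : ℕ) : IsRestrictedSum l m (4 ^ k * N) := by
  induction k using Nat.strong_induction_on with
  | _ k ih =>
    by_cases hk : m ≤ k
    · obtain ⟨j, rfl⟩ := Nat.exists_eq_add_of_le hk
      rw [pow_add, mul_assoc]
      exact (ih j (by omega)).four_pow_mul
    · have hk' : k = 0 ∨ k = 1 ∨ k = 2 ∧ m = 3 := by omega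
      rcases hk' with rfl | rfl | ⟨rfl, rfl⟩ <;> rcases hl with rfl | rfl
      · exact isRestrictedSum_of_three_squares 1 1 (15 * N - 1) (by simp) (by omega) (by omega)
          (by omega)
      · exact isRestrictedSum_of_three_squares 1 1 (15 * N - 4) (by simp) (by omega) (by omega)
          (by omega)
      · exact isRestrictedSum_of_three_squares 1 1 (60 * N - 1) (by simp; ring) (by omega)
          (by omega) (by omega)
      · exact isRestrictedSum_of_three_squares 1 2 (15 * N - 1) (by simp; ring) (by omega)
          (by omega) (by omega)
      · exact isRestrictedSum_of_three_squares 2 4 (15 * N - 4) (by push_cast; ring) (by omega)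
          (by omega) (by omega)
      · exact isRestrictedSum_of_three_squares 1 2 (60 * N - 1) (by simp; ring) (by omega)
          (by omega) (by omega)

theorem stmt_7 (l : ℤ) (hl : l = 1 ∨ l = 2) (m : ℕ) (hm : m = 2 ∨ m = 3) (n : ℕ) :
    ∃ x y z w : ℤ, (n : ℤ) = x ^ 2 + y ^ 2 + z ^ 2 + w ^ 2 ∧
      ∃ r : ℕ, x + 2 * y + 3 * z - w = l * (r : ℤ) ^ m := by
  change IsRestrictedSum l m n
  have hm0 : m ≠ 0 := by omega
  rcases n.eq_zero_or_pos with rfl | hn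
  · exact ⟨0, 0, 0, 0, by simp, 0, by simp [hm0]⟩
  obtain ⟨k, N, rfl, hN⟩ := exists_eq_four_pow_mul hn
  have hN0 : 0 < N := by omega
  push_cast
  by_cases h1 : N % 8 = 1
  · exact isRestrictedSum_four_pow_mul hl hm (by omega) (by omega) k
  · refine isRestrictedSum_of_three_squares 0 (2 ^ k) (15 * N) ?_ (by omega) (by omega) (by omega)
    rw [← pow_mul, mul_comm k, pow_mul]
    simp [hm0]
    ring
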